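/- In the stochastic SQP setting with pre-specified stepsizes described in the context, assume additionally that ν ∈ (0, σ/(2(κ_v(τ_min·L + Γ) + 4))]. Then for every K ∈ ℕ: ∑_{k=0}^{K−1} 𝔼[ α_k·β_k·τ_min·(u_k^true)ᵀH_k u_k^true + (α_k·σ/2)·‖c(x_k)‖₁ ] ≤ τ_min·(f(x₀) − f_low) + ‖c(x₀)‖₁ + κ₁·∑_{k=0}^{K−1} β_k². -/

import Mathlib

open Matrix MeasureTheory RealInnerProductSpace

/-- The ℓ¹-norm of a vector in `ℝ^m`. -/
noncomputable def l1Norm {k : ℕ} (v : EuclideanSpace ℝ (Fin k)) : ℝ := ∑ i, |v i|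

/-- The Jacobian matrix of `c` at `z`, whose rows are the gradients of the components. -/
noncomputable def Jmat {m n : ℕ}
    (gradc : Fin m → EuclideanSpace ℝ (Fin n) → EuclideanSpace ℝ (Fin n))
    (z : EuclideanSpace ℝ (Fin n)) : Matrix (Fin m) (Fin n) ℝ :=
  Matrix.of fun i j => gradc i z j

/-- The Euclidean norm is dominated by the ℓ¹-norm. -/
lemma norm_le_l1Norm {k : ℕ} (z : EuclideanSpace ℝ (Fin k)) : ‖z‖ ≤ l1Norm z := by
  have h0 : 0 ≤ l1Norm z := Finset.sum_nonneg fun i _ => abs_nonneg _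
  rw [EuclideanSpace.norm_eq]
  refine Real.sqrt_le_iff.2 ⟨h0, ?_⟩
  exact Finset.sum_sq_le_sq_sum_of_nonneg fun i _ => norm_nonneg (z i)

lemma l1Norm_nonneg {k : ℕ} (z : EuclideanSpace ℝ (Fin k)) : 0 ≤ l1Norm z :=
  Finset.sum_nonneg fun _ _ => abs_nonneg _

lemma inner_toEuclideanLin_transpose {m n : ℕ} (A : Matrix (Fin m) (Fin n) ℝ)
    (z : EuclideanSpace ℝ (Fin m)) (w : EuclideanSpace ℝ (Fin n)) :
    ⟪Matrix.toEuclideanLin Aᵀ z, w⟫ = ⟪z, Matrix.toEuclideanLin A w⟫ := by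
  have h := Matrix.toEuclideanLin_conjTranspose_eq_adjoint A
  rw [Matrix.conjTranspose_eq_transpose_of_trivial] at h
  rw [h, LinearMap.adjoint_inner_left]

/-- The quadratic upper bound for a function with Lipschitz gradient. -/
lemma le_quadratic_of_lipschitz_gradient {E : Type*} [NormedAddCommGroup E]
    [InnerProductSpace ℝ E] [CompleteSpace E] {h : E → ℝ} {G : E → E} {L : ℝ}
    (hG : ∀ z, HasGradientAt h (G z) z) (hLip : ∀ z z', ‖G z - G z'‖ ≤ L * ‖z - z'‖)
    (z d : E) : h (z + d) ≤ h z + ⟪G z, d⟫ + L / 2 * ‖d‖ ^ 2 := by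
  have hder : ∀ t : ℝ, HasDerivAt (fun t : ℝ => h (z + t • d)) ⟪G (z + t • d), d⟫ t := by
    intro t
    have h1 : HasDerivAt (fun t : ℝ => z + t • d) d t := by
      simpa using ((hasDerivAt_id t).smul_const d).const_add z
    have h2 := (hG (z + t • d)).hasFDerivAt.comp_hasDerivAt t h1
    rw [InnerProductSpace.toDual_apply_apply] at h2
    exact h2
  have hder' : ∀ t : ℝ, HasDerivAt (fun t : ℝ => h z + t * ⟪G z, d⟫ + L / 2 * t ^ 2 * ‖d‖ ^ 2)
      (⟪G z, d⟫ + L * t * ‖d‖ ^ 2) t := by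
    intro t
    have h1 := ((hasDerivAt_id t).mul_const ⟪G z, d⟫).const_add (h z)
    have h2 := (((hasDerivAt_pow 2 t).const_mul (L / 2)).mul_const (‖d‖ ^ 2))
    refine (h1.add h2).congr_deriv ?_
    push_cast
    ring
  have key := image_le_of_deriv_right_le_deriv_boundary (a := 0) (b := 1)
    (fun t _ => (hder t).continuousAt.continuousWithinAt)
    (fun t _ => (hder t).hasDerivWithinAt) (B := fun t : ℝ => h z + t * ⟪G z, d⟫ +
      L / 2 * t ^ 2 * ‖d‖ ^ 2) (by simp)
    (fun t _ => (hder' t).continuousAt.continuousWithinAt)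
    (fun t _ => (hder' t).hasDerivWithinAt) ?_ (Set.right_mem_Icc.2 zero_le_one)
  · simpa using key
  · intro t ht
    have h1 : ⟪G (z + t • d) - G z, d⟫ ≤ L * t * ‖d‖ ^ 2 := calc
      _ ≤ ‖G (z + t • d) - G z‖ * ‖d‖ := real_inner_le_norm _ _
      _ ≤ L * ‖z + t • d - z‖ * ‖d‖ := by gcongr; exact hLip _ _
      _ = L * t * ‖d‖ ^ 2 := by
        rw [add_sub_cancel_left, norm_smul, Real.norm_of_nonneg ht.1]; ring
    rw [inner_sub_left] at h1
    linarith

/-- The two-sided quadratic bound for a function with Lipschitz gradient. -/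
lemma abs_sub_le_quadratic_of_lipschitz_gradient {E : Type*} [NormedAddCommGroup E]
    [InnerProductSpace ℝ E] [CompleteSpace E] {h : E → ℝ} {G : E → E} {L : ℝ}
    (hG : ∀ z, HasGradientAt h (G z) z) (hLip : ∀ z z', ‖G z - G z'‖ ≤ L * ‖z - z'‖)
    (z d : E) : |h (z + d) - (h z + ⟪G z, d⟫)| ≤ L / 2 * ‖d‖ ^ 2 := by
  have h1 := le_quadratic_of_lipschitz_gradient hG hLip z d
  have h2 := le_quadratic_of_lipschitz_gradient (h := fun z => - h z) (G := fun z => - G z)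
    (L := L) (fun z => by
      have := (hG z).hasFDerivAt.neg
      rw [hasGradientAt_iff_hasFDerivAt]
      rw [map_neg]
      exact this)
    (fun z z' => by
      have := hLip z z'
      rwa [← norm_neg, neg_sub_neg, neg_sub]) z d
  rw [inner_neg_left] at h2
  rw [abs_le]
  constructor <;> linarith

lemma toEuclideanLin_Jmat_apply {m n : ℕ}
    (gradc : Fin m → EuclideanSpace ℝ (Fin n) → EuclideanSpace ℝ (Fin n))
    (z d : EuclideanSpace ℝ (Fin n)) (i : Fin m) :
    Matrix.toEuclideanLin (Jmat gradc z) d i = ⟪gradc i z, d⟫ := by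
  simp [Matrix.ofLp_toLpLin, Matrix.mulVec, dotProduct, Jmat, PiLp.inner_apply, mul_comm]

lemma l1Norm_add_le_of_lipschitz_gradient {m n : ℕ}
    {c : EuclideanSpace ℝ (Fin n) → EuclideanSpace ℝ (Fin m)}
    {gradc : Fin m → EuclideanSpace ℝ (Fin n) → EuclideanSpace ℝ (Fin n)} {γ : Fin m → ℝ}
    (hc : ∀ i z, HasGradientAt (fun w => c w i) (gradc i z) z)
    (hcLip : ∀ i z z', ‖gradc i z - gradc i z'‖ ≤ γ i * ‖z - z'‖)
    (z d : EuclideanSpace ℝ (Fin n)) :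
    l1Norm (c (z + d)) ≤ l1Norm (c z + Matrix.toEuclideanLin (Jmat gradc z) d)
      + (∑ i, γ i) / 2 * ‖d‖ ^ 2 := by
  unfold l1Norm
  rw [Finset.sum_div, Finset.sum_mul, ← Finset.sum_add_distrib]
  refine Finset.sum_le_sum fun i _ => ?_
  have h1 := abs_sub_le_quadratic_of_lipschitz_gradient (hc i) (hcLip i) z d
  have h2 : (c z + Matrix.toEuclideanLin (Jmat gradc z) d) i = c z i + ⟪gradc i z, d⟫ := by
    rw [← toEuclideanLin_Jmat_apply]; rfl
  rw [h2]
  have h3 := abs_sub_abs_le_abs_sub (c (z + d) i) (c z i + ⟪gradc i z, d⟫)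
  linarith

lemma l1Norm_smul {k : ℕ} (a : ℝ) (z : EuclideanSpace ℝ (Fin k)) :
    l1Norm (a • z) = |a| * l1Norm z := by
  simp [l1Norm, abs_mul, Finset.mul_sum]

/-- A vector in the range of `Aᵀ` is controlled by its image under `A`. -/
lemma norm_le_of_mem_range_transpose {m n : ℕ} {A : Matrix (Fin m) (Fin n) ℝ} {s : ℝ}
    (hs : 0 < s) (hA : ∀ z, s * ‖z‖ ≤ ‖Matrix.toEuclideanLin Aᵀ z‖)
    {v : EuclideanSpace ℝ (Fin n)} (hv : ∃ z, v = Matrix.toEuclideanLin Aᵀ z) :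
    ‖v‖ ≤ 1 / s * ‖Matrix.toEuclideanLin A v‖ := by
  obtain ⟨z, hz⟩ := hv
  have h1 := hA z
  rw [← hz] at h1
  have h2 : ‖v‖ ^ 2 ≤ ‖z‖ * ‖Matrix.toEuclideanLin A v‖ := by
    have := inner_toEuclideanLin_transpose A z v
    rw [← hz, real_inner_self_eq_norm_sq] at this
    rw [this]
    exact real_inner_le_norm _ _
  rcases (norm_nonneg v).eq_or_lt with h0 | h0
  · rw [← h0]; positivity
  · rw [one_div, ← div_eq_inv_mul, le_div_iff₀ hs]
    have h3 : s * ‖v‖ ^ 2 ≤ ‖v‖ * ‖Matrix.toEuclideanLin A v‖ := by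
      calc s * ‖v‖ ^ 2 ≤ s * (‖z‖ * ‖Matrix.toEuclideanLin A v‖) := by gcongr
        _ = (s * ‖z‖) * ‖Matrix.toEuclideanLin A v‖ := by ring
        _ ≤ _ := by gcongr
    refine le_of_mul_le_mul_left ?_ h0
    linarith

lemma measurable_matrix_inv_apply {ι Ω : Type*} [Fintype ι] [DecidableEq ι]
    [MeasurableSpace Ω] {A : Ω → Matrix ι ι ℝ} (hA : ∀ i j, Measurable fun ω => A ω i j)
    (i j : ι) : Measurable fun ω => (A ω)⁻¹ i j := by
  have hdet : ∀ B : Ω → Matrix ι ι ℝ, (∀ i j, Measurable fun ω => B ω i j) →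
      Measurable fun ω => (B ω).det := by
    intro B hB
    simp only [Matrix.det_apply]
    refine Finset.measurable_sum _ fun σ _ => ?_
    exact (Finset.measurable_prod _ fun i _ => hB _ _).const_smul _
  simp only [Matrix.inv_def, Matrix.smul_apply, Matrix.adjugate_apply, Ring.inverse_eq_inv',
    smul_eq_mul]
  refine (hdet A hA).inv.mul (hdet _ fun a b => ?_)
  by_cases h : a = j
  · subst h; simp
  · simpa [Matrix.updateRow_ne h] using hA a b

/-- The KKT matrix with transposed Hessian. -/
noncomputable def adjointKKT {m n : ℕ} (H : Matrix (Fin n) (Fin n) ℝ)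
    (J : Matrix (Fin m) (Fin n) ℝ) : Matrix (Fin n ⊕ Fin m) (Fin n ⊕ Fin m) ℝ :=
  Matrix.fromBlocks Hᵀ Jᵀ J 0

/-- The primal part of the solution of the adjoint KKT system with right-hand side `(w, 0)`. -/
noncomputable def adjointKKTSol {m n : ℕ} (H : Matrix (Fin n) (Fin n) ℝ)
    (J : Matrix (Fin m) (Fin n) ℝ) (w : EuclideanSpace ℝ (Fin n)) : EuclideanSpace ℝ (Fin n) :=
  WithLp.toLp 2 fun i => ((adjointKKT H J)⁻¹ *ᵥ Sum.elim w 0) (Sum.inl i)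

lemma isUnit_det_adjointKKT {m n : ℕ} {H : Matrix (Fin n) (Fin n) ℝ}
    {J : Matrix (Fin m) (Fin n) ℝ} {s ζ : ℝ} (hs : 0 < s) (hζ : 0 < ζ)
    (hpd : ∀ z, Matrix.toEuclideanLin J z = 0 → ζ * ‖z‖ ^ 2 ≤ ⟪z, Matrix.toEuclideanLin H z⟫)
    (hJ : ∀ z, s * ‖z‖ ≤ ‖Matrix.toEuclideanLin Jᵀ z‖) : IsUnit (adjointKKT H J).det := by
  rw [← Matrix.isUnit_iff_isUnit_det, ← Matrix.mulVec_injective_iff_isUnit]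
  refine (injective_iff_map_eq_zero (Matrix.mulVecLin (adjointKKT H J))).2 fun a ha => ?_
  rw [Matrix.mulVecLin_apply, adjointKKT, Matrix.fromBlocks_mulVec] at ha
  have h1 : Hᵀ *ᵥ (a ∘ Sum.inl) + Jᵀ *ᵥ (a ∘ Sum.inr) = 0 := by
    funext i; simpa using congrFun ha (Sum.inl i)
  have h2 : J *ᵥ (a ∘ Sum.inl) = 0 := by
    funext i; simpa using congrFun ha (Sum.inr i)
  set p : EuclideanSpace ℝ (Fin n) := WithLp.toLp 2 (a ∘ Sum.inl) with hp
  set q : EuclideanSpace ℝ (Fin m) := WithLp.toLp 2 (a ∘ Sum.inr) with hq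
  have h1' : Matrix.toEuclideanLin Hᵀ p + Matrix.toEuclideanLin Jᵀ q = 0 := by
    ext i; simpa [Matrix.ofLp_toLpLin] using congrFun h1 i
  have h2' : Matrix.toEuclideanLin J p = 0 := by
    ext i; simpa [Matrix.ofLp_toLpLin] using congrFun h2 i
  have hp0 : p = 0 := by
    have h3 := congrArg (fun t => ⟪t, p⟫) h1'
    simp only [inner_add_left, inner_toEuclideanLin_transpose, h2', inner_zero_right,
      inner_zero_left, add_zero] at h3
    have h4 := hpd p h2'
    rw [h3] at h4
    have : ‖p‖ ^ 2 ≤ 0 := by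
      by_contra! h
      have := mul_pos hζ h
      linarith
    simpa using le_antisymm this (sq_nonneg _)
  have hq0 : q = 0 := by
    rw [hp0, map_zero, zero_add] at h1'
    have h4 := hJ q
    rw [h1', norm_zero] at h4
    have : ‖q‖ ≤ 0 := by
      by_contra! h
      have := mul_pos hs h
      linarith
    simpa using this
  funext i
  rcases i with i | i
  · exact congrArg (fun t : EuclideanSpace ℝ (Fin n) => t i) hp0
  · exact congrArg (fun t : EuclideanSpace ℝ (Fin m) => t i) hq0

lemma exists_adjointKKTSol_spec {m n : ℕ} {H : Matrix (Fin n) (Fin n) ℝ}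
    {J : Matrix (Fin m) (Fin n) ℝ} (hdet : IsUnit (adjointKKT H J).det)
    (w : EuclideanSpace ℝ (Fin n)) :
    Matrix.toEuclideanLin J (adjointKKTSol H J w) = 0 ∧
    ∃ z, Matrix.toEuclideanLin Hᵀ (adjointKKTSol H J w) + Matrix.toEuclideanLin Jᵀ z = w := by
  set a := (adjointKKT H J)⁻¹ *ᵥ Sum.elim w 0 with ha
  have h : adjointKKT H J *ᵥ a = Sum.elim w 0 := by
    rw [ha, Matrix.mulVec_mulVec, Matrix.mul_nonsing_inv _ hdet, Matrix.one_mulVec]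
  rw [adjointKKT, Matrix.fromBlocks_mulVec] at h
  have hsol : adjointKKTSol H J w = WithLp.toLp 2 (a ∘ Sum.inl) := rfl
  rw [hsol]
  refine ⟨?_, WithLp.toLp 2 (a ∘ Sum.inr), ?_⟩
  · ext i; simpa [Matrix.ofLp_toLpLin] using congrFun h (Sum.inr i)
  · ext i; simpa [Matrix.ofLp_toLpLin] using congrFun h (Sum.inl i)

/-- Pairing with a KKT solution equals, up to sign, pairing its right-hand side with the solution
of the adjoint system. -/
lemma inner_eq_neg_inner_adjointKKTSol {m n : ℕ} {H : Matrix (Fin n) (Fin n) ℝ}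
    {J : Matrix (Fin m) (Fin n) ℝ} (hdet : IsUnit (adjointKKT H J).det)
    {e δ : EuclideanSpace ℝ (Fin n)} {y : EuclideanSpace ℝ (Fin m)}
    (he : Matrix.toEuclideanLin J e = 0)
    (hsys : Matrix.toEuclideanLin H e + Matrix.toEuclideanLin Jᵀ y = -δ)
    (w : EuclideanSpace ℝ (Fin n)) : ⟪w, e⟫ = -⟪adjointKKTSol H J w, δ⟫ := by
  obtain ⟨h1, z, h2⟩ := exists_adjointKKTSol_spec hdet w
  set q := adjointKKTSol H J w
  have h3 : ⟪q, Matrix.toEuclideanLin Jᵀ y⟫ = 0 := by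
    rw [real_inner_comm, inner_toEuclideanLin_transpose, h1, inner_zero_right]
  calc ⟪w, e⟫ = ⟪q, Matrix.toEuclideanLin H e⟫ := by
        rw [← h2, inner_add_left, inner_toEuclideanLin_transpose, inner_toEuclideanLin_transpose,
          he, inner_zero_right, add_zero]
    _ = ⟪q, Matrix.toEuclideanLin H e + Matrix.toEuclideanLin Jᵀ y⟫ := by
        rw [inner_add_right, h3, add_zero]
    _ = _ := by rw [hsys, inner_neg_right]

lemma stronglyMeasurable_adjointKKTSol {m n : ℕ} {Ω : Type*} [MeasurableSpace Ω]
    {H : Ω → Matrix (Fin n) (Fin n) ℝ} {J : Ω → Matrix (Fin m) (Fin n) ℝ}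
    {w : Ω → EuclideanSpace ℝ (Fin n)} (hH : ∀ i j, Measurable fun ω => H ω i j)
    (hJ : ∀ i j, Measurable fun ω => J ω i j) (hw : Measurable w) :
    StronglyMeasurable fun ω => adjointKKTSol (H ω) (J ω) (w ω) := by
  refine Measurable.stronglyMeasurable ?_
  refine (WithLp.measurable_toLp 2 _).comp (measurable_pi_lambda _ fun i => ?_)
  change Measurable fun ω => ∑ j, (adjointKKT (H ω) (J ω))⁻¹ (Sum.inl i) j *
    (Sum.elim (w ω) 0 : Fin n ⊕ Fin m → ℝ) j
  refine Finset.measurable_sum _ fun j _ => Measurable.mul ?_ ?_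
  · refine measurable_matrix_inv_apply (fun a b => ?_) _ _
    rcases a with a | a <;> rcases b with b | b <;> simp [adjointKKT, hH, hJ]
  · rcases j with j | j
    · exact (EuclideanSpace.proj (𝕜 := ℝ) j).continuous.measurable.comp hw
    · exact measurable_const

lemma integral_inner_eq_zero_of_condExp_eq_zero {Ω E : Type*} [NormedAddCommGroup E]
    [InnerProductSpace ℝ E] [CompleteSpace E] {m m0 : MeasurableSpace Ω} {μ : Measure Ω}
    [IsFiniteMeasure μ] (hm : m ≤ m0) {q δ : Ω → E} (hq : StronglyMeasurable[m] q)
    (hδ : Integrable δ μ) (hqδ : Integrable (fun ω => ⟪q ω, δ ω⟫) μ)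
    (h0 : μ[δ | m] =ᵐ[μ] 0) : ∫ ω, ⟪q ω, δ ω⟫ ∂μ = 0 := by
  have h := condExp_bilin_of_stronglyMeasurable_left (innerSL ℝ) hq hqδ hδ
  calc ∫ ω, ⟪q ω, δ ω⟫ ∂μ = ∫ ω, (μ[fun ω => ⟪q ω, δ ω⟫ | m]) ω ∂μ := (integral_condExp hm).symm
    _ = ∫ ω, (0 : ℝ) ∂μ := by
      refine integral_congr_ae ?_
      filter_upwards [h, h0] with ω h1 h2
      rw [h2, Pi.zero_apply, map_zero] at h1
      exact h1
    _ = 0 := by simp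

lemma measurable_toEuclideanLin_apply {m n : ℕ} {Ω : Type*} [MeasurableSpace Ω]
    {A : Ω → Matrix (Fin m) (Fin n) ℝ} {w : Ω → EuclideanSpace ℝ (Fin n)}
    (hA : ∀ i j, Measurable fun ω => A ω i j) (hw : Measurable w) :
    Measurable fun ω => Matrix.toEuclideanLin (A ω) (w ω) := by
  refine (WithLp.measurable_toLp 2 _).comp (measurable_pi_lambda _ fun i => ?_)
  change Measurable fun ω => ∑ j, A ω i j * w ω j
  exact Finset.measurable_sum _ fun j _ =>
    (hA i j).mul ((EuclideanSpace.proj (𝕜 := ℝ) j).continuous.measurable.comp hw)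

/-- The energy identity for a solution of the KKT system. -/
lemma inner_toEuclideanLin_self_of_kkt {m n : ℕ} {H : Matrix (Fin n) (Fin n) ℝ}
    {J : Matrix (Fin m) (Fin n) ℝ} {e δ : EuclideanSpace ℝ (Fin n)}
    {y : EuclideanSpace ℝ (Fin m)} (he : Matrix.toEuclideanLin J e = 0)
    (hsys : Matrix.toEuclideanLin H e + Matrix.toEuclideanLin Jᵀ y = -δ) :
    ⟪e, Matrix.toEuclideanLin H e⟫ = -⟪e, δ⟫ := by
  have h : ⟪e, Matrix.toEuclideanLin Jᵀ y⟫ = 0 := by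
    rw [real_inner_comm, inner_toEuclideanLin_transpose, he, inner_zero_right]
  rw [← inner_neg_right, ← hsys, inner_add_right, h, add_zero]

lemma norm_le_of_kkt {m n : ℕ} {H : Matrix (Fin n) (Fin n) ℝ}
    {J : Matrix (Fin m) (Fin n) ℝ} {e δ : EuclideanSpace ℝ (Fin n)}
    {y : EuclideanSpace ℝ (Fin m)} {ζ : ℝ} (hζ : 0 < ζ)
    (hpd : ζ * ‖e‖ ^ 2 ≤ ⟪e, Matrix.toEuclideanLin H e⟫) (he : Matrix.toEuclideanLin J e = 0)
    (hsys : Matrix.toEuclideanLin H e + Matrix.toEuclideanLin Jᵀ y = -δ) :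
    ‖e‖ ≤ ζ⁻¹ * ‖δ‖ := by
  rw [inner_toEuclideanLin_self_of_kkt he hsys, ← inner_neg_right] at hpd
  have h1 := real_inner_le_norm e (-δ)
  rw [norm_neg] at h1
  rcases (norm_nonneg e).eq_or_lt with h0 | h0
  · rw [← h0]; positivity
  · rw [← div_eq_inv_mul, le_div_iff₀ hζ]
    refine le_of_mul_le_mul_left ?_ h0
    linarith

lemma abs_one_sub_stepsize_bound {α ν t σ q N C : ℝ} (hν : 0 ≤ ν) (h1 : ν ≤ α) (h2 : α ≤ ν + t)
    (hq : 0 ≤ q) (hνσ : (q + 4) * ν ≤ σ / 2) (hN : 0 ≤ N) (hNC : N ≤ C) :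
    α * (1 - σ) * N + (|1 - α| - 1) * N + q / 2 * α ^ 2 * N
      ≤ -(α * σ / 2 * N) + t ^ 2 * (q + 4) * C := by
  have ha : |1 - α| - 1 ≤ -α + 2 * α ^ 2 := by
    rcases le_total 0 (1 - α) with h | h
    · rw [abs_of_nonneg h]; nlinarith
    · rw [abs_of_nonpos h]; nlinarith
  have hα : 0 ≤ α := hν.trans h1
  have hb : (α - ν) ^ 2 ≤ t ^ 2 := pow_le_pow_left₀ (by linarith) (by linarith) 2
  have hc : α * (1 - σ) + (|1 - α| - 1) + q / 2 * α ^ 2 + α * σ / 2 ≤ t ^ 2 * (q + 4) := by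
    have h3 : α * ((q + 4) * ν) ≤ α * (σ / 2) := mul_le_mul_of_nonneg_left hνσ hα
    have h4 : (q + 4) * (α - ν) ^ 2 ≤ (q + 4) * t ^ 2 :=
      mul_le_mul_of_nonneg_left hb (by linarith)
    have h5 : 0 ≤ (q + 4) * ν ^ 2 := by positivity
    have h6 : 0 ≤ (q + 4) * t ^ 2 := by positivity
    nlinarith
  have hd := mul_le_mul_of_nonneg_right hc hN
  have he : t ^ 2 * (q + 4) * N ≤ t ^ 2 * (q + 4) * C := by gcongr
  linarith

/-- One-step decrease of the merit function `τ f + ‖c‖₁`, where `f₀, N` and `f₁, N₁` are the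
objective and infeasibility values before and after the step. -/
lemma merit_decrease {E : Type*} [NormedAddCommGroup E] [InnerProductSpace ℝ E]
    {G ut e v Hut Hv : E} {α β ν θ σ τ L Γ κv κβ κg κH κu κc f₀ f₁ N N₁ U : ℝ}
    (hf : f₁ ≤ f₀ + ⟪G, α • (β • (ut + e) + v)⟫ + L / 2 * ‖α • (β • (ut + e) + v)‖ ^ 2)
    (hc : N₁ ≤ |1 - α| * N + Γ / 2 * ‖α • (β • (ut + e) + v)‖ ^ 2)
    (horth : ⟪ut + e, v⟫ = 0) (hv : ‖v‖ ≤ κv * N) (hv2 : ‖v‖ ^ 2 ≤ κv * N)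
    (hG : ‖G‖ ≤ κg) (hut : ‖ut‖ ≤ κu) (hut2 : ‖ut‖ ^ 2 ≤ U) (hHv : ‖Hv‖ ≤ κH * ‖v‖)
    (hHut : ⟪ut, Hut⟫ = -⟪ut, G + Hv⟫)
    (hν : 0 ≤ ν) (hα : ν ≤ α) (hα' : α ≤ ν + θ * β) (hβ : 0 ≤ β) (hβ' : β ≤ κβ) (hθ : 0 ≤ θ)
    (hτ : 0 ≤ τ) (hP : 0 ≤ τ * L + Γ) (hκv : 0 ≤ κv) (hκH : 0 ≤ κH) (hκu : 0 ≤ κu)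
    (hκg : 0 ≤ κg) (hτσ : τ * (κv * (κβ * κH * κu + κg)) = 1 - σ)
    (hνσ : (κv * (τ * L + Γ) + 4) * ν ≤ σ / 2) (hN : 0 ≤ N) (hNc : N ≤ κc) :
    α * β * τ * ⟪ut, Hut⟫ + α * σ / 2 * N ≤ τ * f₀ + N - (τ * f₁ + N₁)
      + ((θ * β) ^ 2 * (κv * (τ * L + Γ) + 4) * κc
        + (τ * L + Γ) / 2 * (ν + θ * κβ) ^ 2 * β ^ 2 * (U + 2 * ⟪ut, e⟫ + ‖e‖ ^ 2)
        + ν * β * τ * ⟪G, e⟫ + θ * β ^ 2 * τ * κg * ‖e‖) := by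
  have hα0 : 0 ≤ α := hν.trans hα
  have hd : ‖α • (β • (ut + e) + v)‖ ^ 2 = α ^ 2 * (β ^ 2 * ‖ut + e‖ ^ 2 + ‖v‖ ^ 2) := by
    rw [norm_smul, mul_pow, Real.norm_eq_abs, sq_abs, norm_add_sq_real, inner_smul_left, horth,
      norm_smul, mul_pow, Real.norm_eq_abs, sq_abs]
    ring
  have hu : ‖ut + e‖ ^ 2 ≤ U + 2 * ⟪ut, e⟫ + ‖e‖ ^ 2 := by
    rw [norm_add_sq_real]; linarith
  rw [hd] at hf hc
  rw [inner_smul_right, inner_add_right, inner_smul_right, inner_add_right] at hf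
  have hmodel : τ * (β * ⟪G, ut⟫ + ⟪G, v⟫) ≤ -(τ * β * ⟪ut, Hut⟫) + (1 - σ) * N := by
    have h1 : ⟪G, v⟫ ≤ κg * (κv * N) :=
      (real_inner_le_norm _ _).trans (by gcongr)
    have h2 : -⟪ut, Hv⟫ ≤ κu * (κH * (κv * N)) := by
      rw [← inner_neg_right]
      refine (real_inner_le_norm _ _).trans ?_
      rw [norm_neg]
      gcongr
      exact hHv.trans (by gcongr)
    have h3 : β * -⟪ut, Hv⟫ ≤ κβ * (κu * (κH * (κv * N))) :=
      (mul_le_mul_of_nonneg_left h2 hβ).trans (by gcongr)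
    rw [inner_add_right, real_inner_comm G ut] at hHut
    rw [← hτσ, hHut]
    have h4 := mul_le_mul_of_nonneg_left (add_le_add h1 h3) hτ
    linarith
  have hnoise : (α - ν) * (τ * β * ⟪G, e⟫) ≤ θ * β ^ 2 * τ * κg * ‖e‖ := by
    have h1 : ⟪G, e⟫ ≤ κg * ‖e‖ := (real_inner_le_norm _ _).trans (by gcongr)
    calc (α - ν) * (τ * β * ⟪G, e⟫) ≤ (α - ν) * (τ * β * (κg * ‖e‖)) := by
          have : 0 ≤ α - ν := by linarith
          gcongr
      _ ≤ (θ * β) * (τ * β * (κg * ‖e‖)) := by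
          gcongr; linarith
      _ = _ := by ring
  have htang : (τ * L + Γ) / 2 * (α ^ 2 * (β ^ 2 * ‖ut + e‖ ^ 2))
      ≤ (τ * L + Γ) / 2 * (ν + θ * κβ) ^ 2 * β ^ 2 * (U + 2 * ⟪ut, e⟫ + ‖e‖ ^ 2) := by
    have h1 : α ≤ ν + θ * κβ := hα'.trans (by gcongr)
    calc _ ≤ (τ * L + Γ) / 2 * ((ν + θ * κβ) ^ 2 * (β ^ 2 * (U + 2 * ⟪ut, e⟫ + ‖e‖ ^ 2))) := by
          gcongr
      _ = _ := by ring
  have hnorm : (τ * L + Γ) / 2 * (α ^ 2 * ‖v‖ ^ 2)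
      ≤ (τ * L + Γ) / 2 * (α ^ 2 * (κv * N)) := by gcongr
  have hscal := abs_one_sub_stepsize_bound hν hα hα' (mul_nonneg hκv hP) hνσ hN hNc
  have hf' := mul_le_mul_of_nonneg_left hf hτ
  have hmodel' := mul_le_mul_of_nonneg_left hmodel hα0
  linarith

lemma sum_integral_le_of_telescoping {Ω : Type*} {m0 : MeasurableSpace Ω} {μ : Measure Ω}
    [IsProbabilityMeasure μ] {S R : ℕ → Ω → ℝ} {φ : ℕ → Ω → ℝ} {φ₀ φlow κ : ℝ} {b : ℕ → ℝ}
    (hS : ∀ k, Integrable (S k) μ) (hR : ∀ k, Integrable (R k) μ)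
    (hRb : ∀ k, ∫ ω, R k ω ∂μ ≤ κ * b k)
    (hstep : ∀ k ω, S k ω ≤ φ k ω - φ (k + 1) ω + R k ω)
    (hφ₀ : ∀ ω, φ 0 ω = φ₀) (hφlow : ∀ k ω, φlow ≤ φ k ω) (K : ℕ) :
    ∑ k ∈ Finset.range K, ∫ ω, S k ω ∂μ ≤ φ₀ - φlow + κ * ∑ k ∈ Finset.range K, b k := by
  have hpt : ∀ ω, ∑ k ∈ Finset.range K, S k ω
      ≤ φ₀ - φlow + ∑ k ∈ Finset.range K, R k ω := fun ω => by
    have h1 := Finset.sum_le_sum fun k (_ : k ∈ Finset.range K) => hstep k ω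
    rw [Finset.sum_add_distrib, Finset.sum_range_sub' (fun k => φ k ω), hφ₀] at h1
    linarith [hφlow K ω]
  have hRint := integrable_finsetSum (Finset.range K) fun k _ => hR k
  calc ∑ k ∈ Finset.range K, ∫ ω, S k ω ∂μ = ∫ ω, ∑ k ∈ Finset.range K, S k ω ∂μ :=
        (integral_finsetSum _ fun k _ => hS k).symm
    _ ≤ ∫ ω, (φ₀ - φlow + ∑ k ∈ Finset.range K, R k ω) ∂μ :=
        integral_mono (integrable_finsetSum _ fun k _ => hS k)
          ((integrable_const _).add hRint) hpt
    _ = φ₀ - φlow + ∑ k ∈ Finset.range K, ∫ ω, R k ω ∂μ := by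
        rw [integral_add (integrable_const _) hRint, integral_finsetSum _ fun k _ => hR k]
        simp
    _ ≤ _ := by
        rw [Finset.mul_sum]
        gcongr with k
        exact hRb k

/-- Summed expected decrease for the two-stepsize stochastic SQP
method with pre-specified stepsizes (Theorem 3.1 of the paper). -/
theorem stmt9 {m n : ℕ} (hm : 1 ≤ m) (hmn : m ≤ n)
    {Ω : Type*} {m0 : MeasurableSpace Ω} (μ : Measure Ω) [IsProbabilityMeasure μ]
    (ℱ : Filtration ℕ m0)
    -- problem data
    (f : EuclideanSpace ℝ (Fin n) → ℝ)
    (gradf : EuclideanSpace ℝ (Fin n) → EuclideanSpace ℝ (Fin n))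
    (c : EuclideanSpace ℝ (Fin n) → EuclideanSpace ℝ (Fin m))
    (gradc : Fin m → EuclideanSpace ℝ (Fin n) → EuclideanSpace ℝ (Fin n))
    (flow L κg κc s ζ κH M ν θ κβ σ : ℝ) (γ : Fin m → ℝ)
    (hL : 0 < L) (hκg : 0 < κg) (hκc : 0 < κc) (hs : 0 < s) (hζ : 0 < ζ)
    (hκH : 0 < κH) (hM : 0 < M) (hθ : 0 < θ) (hκβ : 0 < κβ)
    (hσ : σ ∈ Set.Ioo (0 : ℝ) 1) (hγ : ∀ i, 0 < γ i)
    (hf : ∀ z, HasGradientAt f (gradf z) z)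
    (hflow : ∀ z, flow ≤ f z)
    (hfLip : ∀ z z', ‖gradf z - gradf z'‖ ≤ L * ‖z - z'‖)
    (hgradb : ∀ z, ‖gradf z‖ ≤ κg)
    (hc : ∀ i z, HasGradientAt (fun w => c w i) (gradc i z) z)
    (hcb : ∀ z, l1Norm (c z) ≤ κc)
    (hcLip : ∀ i z z', ‖gradc i z - gradc i z'‖ ≤ γ i * ‖z - z'‖)
    -- algorithm iterates
    (x0 : EuclideanSpace ℝ (Fin n))
    (x u utrue g v : ℕ → Ω → EuclideanSpace ℝ (Fin n))
    (y ytrue : ℕ → Ω → EuclideanSpace ℝ (Fin m))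
    (H : ℕ → Ω → Matrix (Fin n) (Fin n) ℝ)
    (α : ℕ → Ω → ℝ) (β : ℕ → ℝ)
    (hx0 : ∀ ω, x 0 ω = x0)
    (hxmeas : ∀ k, StronglyMeasurable[ℱ k] (x k))
    (hHmeas : ∀ k i j, StronglyMeasurable[ℱ k] (fun ω => H k ω i j))
    (hHnorm : ∀ k ω (z : EuclideanSpace ℝ (Fin n)),
      ‖Matrix.toEuclideanLin (H k ω) z‖ ≤ κH * ‖z‖)
    (hHpd : ∀ k ω (z : EuclideanSpace ℝ (Fin n)),
      Matrix.toEuclideanLin (Jmat gradc (x k ω)) z = 0 →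
      ζ * ‖z‖ ^ 2 ≤ ⟪z, Matrix.toEuclideanLin (H k ω) z⟫)
    (hsv : ∀ k ω (z : EuclideanSpace ℝ (Fin m)),
      s * ‖z‖ ≤ ‖Matrix.toEuclideanLin (Jmat gradc (x k ω))ᵀ z‖)
    (hgmeas : ∀ k, StronglyMeasurable[ℱ (k + 1)] (g k))
    (hgmean : ∀ k, μ[g k | ℱ k] =ᵐ[μ] fun ω => gradf (x k ω))
    (hgvarint : ∀ k, Integrable (fun ω => ‖g k ω - gradf (x k ω)‖ ^ 2) μ)
    (hgvar : ∀ k, ∀ᵐ ω ∂μ,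
      (μ[fun ω' => ‖g k ω' - gradf (x k ω')‖ ^ 2 | ℱ k]) ω ≤ M)
    (humeas : ∀ k, StronglyMeasurable[ℱ (k + 1)] (u k))
    (hymeas : ∀ k, StronglyMeasurable[ℱ (k + 1)] (y k))
    (hvmeas : ∀ k, StronglyMeasurable[ℱ k] (v k))
    (hutmeas : ∀ k, StronglyMeasurable[ℱ k] (utrue k))
    (hytmeas : ∀ k, StronglyMeasurable[ℱ k] (ytrue k))
    (hJu : ∀ k ω, Matrix.toEuclideanLin (Jmat gradc (x k ω)) (u k ω) = 0)
    (hvrange : ∀ k ω, ∃ z : EuclideanSpace ℝ (Fin m),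
      v k ω = Matrix.toEuclideanLin (Jmat gradc (x k ω))ᵀ z)
    (hJp : ∀ k ω, Matrix.toEuclideanLin (Jmat gradc (x k ω)) (u k ω + v k ω)
      = -(c (x k ω)))
    (hsys : ∀ k ω, Matrix.toEuclideanLin (H k ω) (u k ω + v k ω)
      + Matrix.toEuclideanLin (Jmat gradc (x k ω))ᵀ (y k ω) = -(g k ω))
    (hJut : ∀ k ω, Matrix.toEuclideanLin (Jmat gradc (x k ω)) (utrue k ω) = 0)
    (hsyst : ∀ k ω, Matrix.toEuclideanLin (H k ω) (utrue k ω + v k ω)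
      + Matrix.toEuclideanLin (Jmat gradc (x k ω))ᵀ (ytrue k ω) = -(gradf (x k ω)))
    (hβpos : ∀ k, 0 < β k) (hβb : ∀ k, β k ≤ κβ)
    (hαmeas : ∀ k, StronglyMeasurable[ℱ (k + 1)] (α k))
    (hα : ∀ k ω, α k ω ∈ Set.Icc ν (ν + θ * β k))
    (hupdate : ∀ k ω, x (k + 1) ω = x k ω + α k ω • (β k • u k ω + v k ω))
    -- constants
    (κv κu τmin Γ κ₁ : ℝ)
    (hκv : κv = max (1 / s) (κc / s ^ 2))
    (hκu : κu = ζ⁻¹ * κg + ζ⁻¹ * κH * κv * κc)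
    (hΓ : Γ = ∑ i, γ i)
    (hτmin : τmin = (1 - σ) / (κv * (κβ * κH * κu + κg)))
    (hν : ν ∈ Set.Ioc (0 : ℝ) (σ / (2 * (κv * (τmin * L + Γ) + 4))))
    (hκ₁ : κ₁ = (ν + θ * κβ) ^ 2 * (τmin * L + Γ) * (ζ⁻¹ * κH * κu ^ 2 + ζ⁻¹ ^ 2 * M) / 2
      + θ * (θ * κc * (κv * (τmin * L + Γ) + 4) + τmin * κg * ζ⁻¹ * Real.sqrt M))
    (K : ℕ) :
    ∑ k ∈ Finset.range K,
      ∫ ω, (α k ω * β k * τmin * ⟪utrue k ω, Matrix.toEuclideanLin (H k ω) (utrue k ω)⟫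
        + α k ω * σ / 2 * l1Norm (c (x k ω))) ∂μ
      ≤ τmin * (f x0 - flow) + l1Norm (c x0) + κ₁ * ∑ k ∈ Finset.range K, β k ^ 2 := by
  obtain ⟨hσ0, hσ1⟩ := hσ
  obtain ⟨hν0, hνle⟩ := hν
  have hκv1 : 1 / s ≤ κv := hκv ▸ le_max_left _ _
  have hκv2 : κc / s ^ 2 ≤ κv := hκv ▸ le_max_right _ _
  have hκv0 : 0 < κv := (one_div_pos.2 hs).trans_le hκv1
  have hκu0 : 0 < κu := by rw [hκu]; positivity
  have hden : 0 < κv * (κβ * κH * κu + κg) := by positivity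
  have hτ0 : 0 < τmin := by rw [hτmin]; exact div_pos (by linarith) hden
  have hτσ : τmin * (κv * (κβ * κH * κu + κg)) = 1 - σ := by
    rw [hτmin, div_mul_cancel₀ _ hden.ne']
  have hΓ0 : 0 ≤ Γ := hΓ ▸ Finset.sum_nonneg fun i _ => (hγ i).le
  have hP : 0 ≤ τmin * L + Γ := by positivity
  have hQ : 0 < κv * (τmin * L + Γ) + 4 := by positivity
  have hνσ : (κv * (τmin * L + Γ) + 4) * ν ≤ σ / 2 := by
    rw [le_div_iff₀ (by positivity)] at hνle
    linarith
  have hgradf_cont : Continuous gradf :=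
    (LipschitzWith.of_dist_le_mul (K := L.toNNReal) fun z z' => by
      simpa [dist_eq_norm, hL.le] using hfLip z z').continuous
  have hgradc_cont : ∀ i, Continuous (gradc i) := fun i =>
    (LipschitzWith.of_dist_le_mul (K := (γ i).toNNReal) fun z z' => by
      simpa [dist_eq_norm, (hγ i).le] using hcLip i z z').continuous
  have hl1c_cont : Continuous fun z => l1Norm (c z) :=
    continuous_finsetSum _ fun i _ =>
      (continuous_iff_continuousAt.2 fun z => (hc i z).continuousAt).abs
  -- the noise in the gradient and the resulting error in the tangential step
  set G : ℕ → Ω → EuclideanSpace ℝ (Fin n) := fun k ω => gradf (x k ω) with hGdef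
  set δ : ℕ → Ω → EuclideanSpace ℝ (Fin n) := fun k ω => g k ω - G k ω with hδdef
  set e : ℕ → Ω → EuclideanSpace ℝ (Fin n) := fun k ω => u k ω - utrue k ω with hedef
  have hGmeas : ∀ k, StronglyMeasurable[ℱ k] (G k) := fun k =>
    hgradf_cont.comp_stronglyMeasurable (hxmeas k)
  have hGint : ∀ k, Integrable (G k) μ := fun k =>
    Integrable.of_bound ((hGmeas k).mono (ℱ.le k)).aestronglyMeasurable κg
      (ae_of_all _ fun ω => hgradb _)
  have hδmeas : ∀ k, AEStronglyMeasurable (δ k) μ := fun k =>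
    (((hgmeas k).mono (ℱ.le _)).sub ((hGmeas k).mono (ℱ.le k))).aestronglyMeasurable
  have hδint : ∀ k, Integrable (δ k) μ := fun k =>
    ((memLp_two_iff_integrable_sq_norm (hδmeas k)).2 (hgvarint k)).integrable one_le_two
  have hδcond : ∀ k, μ[δ k | ℱ k] =ᵐ[μ] 0 := fun k => by
    have hgint : Integrable (g k) μ := by
      have h1 : g k = δ k + G k := funext fun ω => (sub_add_cancel _ _).symm
      rw [h1]
      exact (hδint k).add (hGint k)
    have h1 := condExp_sub hgint (hGint k) (ℱ k)
    rw [condExp_of_stronglyMeasurable (ℱ.le k) (hGmeas k) (hGint k)] at h1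
    filter_upwards [h1, hgmean k] with ω h2 h3
    change (μ[g k - G k | ℱ k]) ω = 0
    rw [h2, Pi.sub_apply, h3, sub_self]
  have hδvar : ∀ k, ∫ ω, ‖δ k ω‖ ^ 2 ∂μ ≤ M := fun k => by
    rw [← integral_condExp (ℱ.le k)]
    calc _ ≤ ∫ _, M ∂μ := integral_mono_ae integrable_condExp (integrable_const _) (hgvar k)
      _ = M := by simp
  have hJe : ∀ k ω, Matrix.toEuclideanLin (Jmat gradc (x k ω)) (e k ω) = 0 := fun k ω => by
    rw [hedef, map_sub, hJu, hJut, sub_zero]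
  have hesys : ∀ k ω, Matrix.toEuclideanLin (H k ω) (e k ω)
      + Matrix.toEuclideanLin (Jmat gradc (x k ω))ᵀ (y k ω - ytrue k ω) = -δ k ω := fun k ω => by
    have h1 := congrArg₂ (· - ·) (hsys k ω) (hsyst k ω)
    simp only [map_add] at h1
    simp only [hedef, hδdef, hGdef, map_sub]
    rw [show -(g k ω - gradf (x k ω)) = -g k ω - -gradf (x k ω) by abel, ← h1]
    abel
  have henorm : ∀ k ω, ‖e k ω‖ ≤ ζ⁻¹ * ‖δ k ω‖ := fun k ω =>
    norm_le_of_kkt hζ (hHpd k ω _ (hJe k ω)) (hJe k ω) (hesys k ω)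
  have hemeas : ∀ k, AEStronglyMeasurable (e k) μ := fun k =>
    (((humeas k).mono (ℱ.le _)).sub ((hutmeas k).mono (ℱ.le k))).aestronglyMeasurable
  have hcross : ∀ k (w : Ω → EuclideanSpace ℝ (Fin n)) (C : ℝ), StronglyMeasurable[ℱ k] w →
      (∀ ω, ‖w ω‖ ≤ C) → Integrable (fun ω => ⟪w ω, e k ω⟫) μ ∧ ∫ ω, ⟪w ω, e k ω⟫ ∂μ = 0 := by
    intro k w C hw hwb
    have hint : Integrable (fun ω => ⟪w ω, e k ω⟫) μ := by
      refine Integrable.mono' (((hδint k).norm.const_mul ζ⁻¹).const_mul C)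
        (((hw.mono (ℱ.le k)).aestronglyMeasurable).inner (hemeas k)) (ae_of_all _ fun ω => ?_)
      exact (norm_inner_le_norm _ _).trans (mul_le_mul (hwb ω) (henorm k ω) (norm_nonneg _)
        ((norm_nonneg _).trans (hwb ω)))
    have hq : StronglyMeasurable[ℱ k]
        fun ω => adjointKKTSol (H k ω) (Jmat gradc (x k ω)) (w ω) := by
      refine @stronglyMeasurable_adjointKKTSol m n Ω (ℱ k) _ _ _
        (fun i j => (hHmeas k i j).measurable) (fun i j => ?_) hw.measurable
      exact (((EuclideanSpace.proj (𝕜 := ℝ) j).continuous.comp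
        (hgradc_cont i)).comp_stronglyMeasurable (hxmeas k)).measurable
    have heq : ∀ ω, ⟪w ω, e k ω⟫
        = -⟪adjointKKTSol (H k ω) (Jmat gradc (x k ω)) (w ω), δ k ω⟫ := fun ω =>
      inner_eq_neg_inner_adjointKKTSol (isUnit_det_adjointKKT hs hζ (hHpd k ω) (hsv k ω))
        (hJe k ω) (hesys k ω) _
    refine ⟨hint, ?_⟩
    simp only [heq] at hint ⊢
    rw [integral_neg, integral_inner_eq_zero_of_condExp_eq_zero (ℱ.le k) hq (hδint k) ?_
      (hδcond k), neg_zero]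
    simpa using hint.neg
  -- bounds on the deterministic parts of the step
  have hJv : ∀ k ω, Matrix.toEuclideanLin (Jmat gradc (x k ω)) (v k ω) = -c (x k ω) :=
    fun k ω => by rw [← hJp k ω, map_add, hJu, zero_add]
  have hvs : ∀ k ω, ‖v k ω‖ ≤ 1 / s * l1Norm (c (x k ω)) := fun k ω => by
    have h1 := norm_le_of_mem_range_transpose hs (hsv k ω) (hvrange k ω)
    rw [hJv, norm_neg] at h1
    exact h1.trans (by gcongr; exact norm_le_l1Norm _)
  have hvb : ∀ k ω, ‖v k ω‖ ≤ κv * l1Norm (c (x k ω)) := fun k ω =>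
    (hvs k ω).trans (mul_le_mul_of_nonneg_right hκv1 (l1Norm_nonneg _))
  have hvb2 : ∀ k ω, ‖v k ω‖ ^ 2 ≤ κv * l1Norm (c (x k ω)) := fun k ω => by
    have hN := l1Norm_nonneg (c (x k ω))
    calc ‖v k ω‖ ^ 2 ≤ (1 / s * l1Norm (c (x k ω))) ^ 2 := by gcongr; exact hvs k ω
      _ = l1Norm (c (x k ω)) / s ^ 2 * l1Norm (c (x k ω)) := by ring
      _ ≤ κc / s ^ 2 * l1Norm (c (x k ω)) := by gcongr; exact hcb _
      _ ≤ _ := by gcongr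
  have hutsys : ∀ k ω, Matrix.toEuclideanLin (H k ω) (utrue k ω)
      + Matrix.toEuclideanLin (Jmat gradc (x k ω))ᵀ (ytrue k ω)
      = -(G k ω + Matrix.toEuclideanLin (H k ω) (v k ω)) := fun k ω => by
    have h1 := hsyst k ω
    rw [map_add] at h1
    rw [neg_add, ← h1]
    abel
  have hutb : ∀ k ω, ‖utrue k ω‖ ≤ κu := fun k ω => by
    refine (norm_le_of_kkt hζ (hHpd k ω _ (hJut k ω)) (hJut k ω) (hutsys k ω)).trans ?_
    have h1 : ‖G k ω + Matrix.toEuclideanLin (H k ω) (v k ω)‖ ≤ κg + κH * (κv * κc) := by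
      refine (norm_add_le _ _).trans (add_le_add (hgradb _) ((hHnorm k ω _).trans ?_))
      gcongr
      exact (hvb k ω).trans (by gcongr; exact hcb _)
    calc _ ≤ ζ⁻¹ * (κg + κH * (κv * κc)) := by gcongr
      _ = κu := by rw [hκu]; ring
  have hAub : ∀ k ω, ⟪utrue k ω, Matrix.toEuclideanLin (H k ω) (utrue k ω)⟫ ≤ κH * κu ^ 2 :=
    fun k ω => calc
      _ ≤ ‖utrue k ω‖ * (κH * ‖utrue k ω‖) :=
        (real_inner_le_norm _ _).trans (by gcongr; exact hHnorm k ω _)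
      _ = κH * ‖utrue k ω‖ ^ 2 := by ring
      _ ≤ _ := by gcongr; exact hutb k ω
  have hAlb : ∀ k ω, ζ * ‖utrue k ω‖ ^ 2
      ≤ ⟪utrue k ω, Matrix.toEuclideanLin (H k ω) (utrue k ω)⟫ := fun k ω =>
    hHpd k ω _ (hJut k ω)
  have hutb2 : ∀ k ω, ‖utrue k ω‖ ^ 2 ≤ ζ⁻¹ * κH * κu ^ 2 := fun k ω => by
    rw [mul_assoc, ← div_eq_inv_mul, le_div_iff₀ hζ]
    linarith [hAub k ω, hAlb k ω]
  have horth : ∀ k ω, ⟪u k ω, v k ω⟫ = 0 := fun k ω => by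
    obtain ⟨z, hz⟩ := hvrange k ω
    rw [hz, real_inner_comm, inner_toEuclideanLin_transpose, hJu, inner_zero_right]
  have hmerit : ∀ k ω,
      α k ω * β k * τmin * ⟪utrue k ω, Matrix.toEuclideanLin (H k ω) (utrue k ω)⟫
        + α k ω * σ / 2 * l1Norm (c (x k ω))
      ≤ τmin * f (x k ω) + l1Norm (c (x k ω)) - (τmin * f (x (k + 1) ω) + l1Norm (c (x (k + 1) ω)))
      + ((θ * β k) ^ 2 * (κv * (τmin * L + Γ) + 4) * κc
        + (τmin * L + Γ) / 2 * (ν + θ * κβ) ^ 2 * β k ^ 2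
          * (ζ⁻¹ * κH * κu ^ 2 + 2 * ⟪utrue k ω, e k ω⟫ + ‖e k ω‖ ^ 2)
        + ν * β k * τmin * ⟪G k ω, e k ω⟫ + θ * β k ^ 2 * τmin * κg * ‖e k ω‖) := by
    intro k ω
    have hue : utrue k ω + e k ω = u k ω := add_sub_cancel _ _
    refine merit_decrease (κv := κv) (κu := κu) (κH := κH) (v := v k ω)
      (Hv := Matrix.toEuclideanLin (H k ω) (v k ω)) ?_ ?_ ?_ (hvb k ω) (hvb2 k ω)
      (hgradb _) (hutb k ω) (hutb2 k ω) (hHnorm k ω _)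
      (inner_toEuclideanLin_self_of_kkt (hJut k ω) (hutsys k ω)) hν0.le (hα k ω).1 (hα k ω).2
      (hβpos k).le (hβb k) hθ.le hτ0.le hP hκv0.le hκH.le hκu0.le hκg.le hτσ hνσ
      (l1Norm_nonneg _) (hcb _)
    · rw [hue, hupdate]
      exact le_quadratic_of_lipschitz_gradient hf hfLip _ _
    · rw [hue, hupdate, hΓ, ← l1Norm_smul]
      refine (l1Norm_add_le_of_lipschitz_gradient hc hcLip _ _).trans_eq ?_
      rw [map_smul, map_add, map_smul, hJu, hJv, smul_zero, zero_add, smul_neg, sub_smul,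
        one_smul, ← sub_eq_add_neg]
    · rw [hue]; exact horth k ω
  -- the error terms are integrable, with expectation of order `β k ^ 2`
  have hsM : 0 < √M := Real.sqrt_pos.2 hM
  have hMs : √M * √M = M := Real.mul_self_sqrt hM.le
  let a : ℕ → ℝ := fun k => (θ * β k) ^ 2 * (κv * (τmin * L + Γ) + 4) * κc
    + (τmin * L + Γ) / 2 * (ν + θ * κβ) ^ 2 * β k ^ 2 * (ζ⁻¹ * κH * κu ^ 2)
    + θ * β k ^ 2 * τmin * κg * ζ⁻¹ * (√M / 2)
  let b : ℕ → ℝ := fun k => (τmin * L + Γ) / 2 * (ν + θ * κβ) ^ 2 * β k ^ 2 * ζ⁻¹ ^ 2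
    + θ * β k ^ 2 * τmin * κg * ζ⁻¹ * (1 / (2 * √M))
  let r : ℕ → ℝ := fun k => (τmin * L + Γ) * (ν + θ * κβ) ^ 2 * β k ^ 2
  let R : ℕ → Ω → ℝ := fun k ω => a k + b k * ‖δ k ω‖ ^ 2 + r k * ⟪utrue k ω, e k ω⟫
    + ν * β k * τmin * ⟪G k ω, e k ω⟫
  have hut_cross := fun k => hcross k (utrue k) κu (hutmeas k) (hutb k)
  have hG_cross := fun k => hcross k (G k) κg (hGmeas k) fun ω => hgradb _
  have hI1 : ∀ k, Integrable (fun ω => a k + b k * ‖δ k ω‖ ^ 2) μ := fun k =>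
    (integrable_const _).add ((hgvarint k).const_mul _)
  have hI2 : ∀ k, Integrable (fun ω => a k + b k * ‖δ k ω‖ ^ 2 + r k * ⟪utrue k ω, e k ω⟫) μ :=
    fun k => (hI1 k).add ((hut_cross k).1.const_mul _)
  have hRint : ∀ k, Integrable (R k) μ := fun k => (hI2 k).add ((hG_cross k).1.const_mul _)
  have hb0 : ∀ k, 0 ≤ b k := fun k => by
    have := (hβpos k).le
    positivity
  have hRb : ∀ k, ∫ ω, R k ω ∂μ ≤ κ₁ * β k ^ 2 := fun k => by
    have h1 : ∫ ω, R k ω ∂μ = a k + b k * ∫ ω, ‖δ k ω‖ ^ 2 ∂μ := by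
      change ∫ ω, (a k + b k * ‖δ k ω‖ ^ 2 + r k * ⟪utrue k ω, e k ω⟫
        + ν * β k * τmin * ⟪G k ω, e k ω⟫) ∂μ = _
      rw [integral_add (hI2 k) ((hG_cross k).1.const_mul _),
        integral_add (hI1 k) ((hut_cross k).1.const_mul _),
        integral_add (integrable_const _) ((hgvarint k).const_mul _), integral_const_mul,
        integral_const_mul, integral_const_mul, (hut_cross k).2, (hG_cross k).2, integral_const,
        probReal_univ, one_smul, mul_zero, add_zero, mul_zero, add_zero]
    rw [h1]
    have h2 : 1 / (2 * √M) * M = √M / 2 := by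
      nth_rewrite 2 [← hMs]
      field_simp
    calc a k + b k * ∫ ω, ‖δ k ω‖ ^ 2 ∂μ ≤ a k + b k * M := by
          have := mul_le_mul_of_nonneg_left (hδvar k) (hb0 k)
          linarith
      _ = a k + ((τmin * L + Γ) / 2 * (ν + θ * κβ) ^ 2 * β k ^ 2 * ζ⁻¹ ^ 2 * M
          + θ * β k ^ 2 * τmin * κg * ζ⁻¹ * (√M / 2)) := by
          rw [← h2]; ring
      _ = κ₁ * β k ^ 2 := by rw [hκ₁]; ring
  have hstep : ∀ k ω,
      α k ω * β k * τmin * ⟪utrue k ω, Matrix.toEuclideanLin (H k ω) (utrue k ω)⟫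
        + α k ω * σ / 2 * l1Norm (c (x k ω))
      ≤ τmin * f (x k ω) + l1Norm (c (x k ω)) - (τmin * f (x (k + 1) ω) + l1Norm (c (x (k + 1) ω)))
        + R k ω := by
    intro k ω
    refine (hmerit k ω).trans (add_le_add_right ?_ _)
    have hβ0 := (hβpos k).le
    have h1 : ‖e k ω‖ ^ 2 ≤ ζ⁻¹ ^ 2 * ‖δ k ω‖ ^ 2 := by
      rw [← mul_pow]; gcongr; exact henorm k ω
    have h2 : ‖e k ω‖ ≤ ζ⁻¹ * (1 / (2 * √M) * ‖δ k ω‖ ^ 2 + √M / 2) := by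
      refine (henorm k ω).trans ?_
      gcongr
      have h3 : 1 / (2 * √M) * ‖δ k ω‖ ^ 2 + √M / 2 - ‖δ k ω‖
          = (‖δ k ω‖ - √M) ^ 2 / (2 * √M) := by
        field_simp
        ring
      have h4 : 0 ≤ (‖δ k ω‖ - √M) ^ 2 / (2 * √M) := by positivity
      linarith
    have h5 : 0 ≤ (τmin * L + Γ) / 2 * (ν + θ * κβ) ^ 2 * β k ^ 2 := by positivity
    have h6 : 0 ≤ θ * β k ^ 2 * τmin * κg := by positivity
    have h7 := mul_le_mul_of_nonneg_left h1 h5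
    have h8 := mul_le_mul_of_nonneg_left h2 h6
    simp only [R, a, b, r]
    linarith
  have hSint : ∀ k, Integrable (fun ω =>
      α k ω * β k * τmin * ⟪utrue k ω, Matrix.toEuclideanLin (H k ω) (utrue k ω)⟫
        + α k ω * σ / 2 * l1Norm (c (x k ω))) μ := by
    intro k
    have hαm : Measurable (α k) := ((hαmeas k).mono (ℱ.le _)).measurable
    have hutm : Measurable (utrue k) := ((hutmeas k).mono (ℱ.le _)).measurable
    have hAm : Measurable fun ω =>
        ⟪utrue k ω, Matrix.toEuclideanLin (H k ω) (utrue k ω)⟫ :=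
      hutm.inner (measurable_toEuclideanLin_apply
        (fun i j => ((hHmeas k i j).mono (ℱ.le _)).measurable) hutm)
    have hNm : Measurable fun ω => l1Norm (c (x k ω)) :=
      (hl1c_cont.comp_stronglyMeasurable ((hxmeas k).mono (ℱ.le _))).measurable
    refine Integrable.of_bound (C := (ν + θ * β k) * β k * τmin * (κH * κu ^ 2)
      + (ν + θ * β k) * σ / 2 * κc) (((((hαm.mul_const _).mul_const _).mul hAm).add
        (((hαm.mul_const _).div_const _).mul hNm)).aestronglyMeasurable) (ae_of_all _ fun ω => ?_)
    have hα0 : 0 ≤ α k ω := hν0.le.trans (hα k ω).1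
    have hβ0 := (hβpos k).le
    have hN := l1Norm_nonneg (c (x k ω))
    have hA0 : 0 ≤ ⟪utrue k ω, Matrix.toEuclideanLin (H k ω) (utrue k ω)⟫ :=
      le_trans (by positivity) (hAlb k ω)
    rw [Real.norm_of_nonneg (by positivity)]
    have hα1 := (hα k ω).2
    have hc1 := hcb (x k ω)
    have hA1 := hAub k ω
    gcongr
  have hφlow : ∀ k ω, τmin * flow ≤ τmin * f (x k ω) + l1Norm (c (x k ω)) := fun k ω => by
    have := mul_le_mul_of_nonneg_left (hflow (x k ω)) hτ0.le
    linarith [l1Norm_nonneg (c (x k ω))]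
  refine (sum_integral_le_of_telescoping hSint hRint hRb hstep
    (fun ω => by rw [hx0 ω]) hφlow K).trans_eq ?_
  ring
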